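/- Every Fréchet–Urysohn compact Hausdorff admissible right topological (CHART) group is metrizable. -/

import Mathlib

open Set Filter Topology
open scoped Ordinal

theorem countable_Iio_of_Iio_omega_one (a : Iio (ω₁ : Ordinal.{0})) : (Iio a).Countable := by
  have hcard : (a : Ordinal.{0}).card ≤ Cardinal.aleph0 := by
    have h : (a : Ordinal.{0}) < (Cardinal.aleph 1).ord := by
      rw [Cardinal.ord_aleph]
      exact a.2
    rwa [Cardinal.lt_ord, ← Cardinal.succ_aleph0, Order.lt_succ_iff] at h
  have hc : (Iio (a : Ordinal.{0})).Countable := by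
    rw [← Cardinal.le_aleph0_iff_set_countable, Cardinal.mk_Iio_ordinal]
    rwa [Cardinal.lift_le_aleph0]
  exact (hc.preimage Subtype.val_injective).mono fun b hb => hb

theorem exists_forall_le_of_seq_Iio_omega_one (s : ℕ → Iio (ω₁ : Ordinal.{0})) :
    ∃ a, ∀ n, s n ≤ a :=
  ⟨⟨⨆ n, (s n : Ordinal.{0}), Ordinal.iSup_lt_omega_one fun n => (s n).2⟩,
    fun n => Ordinal.le_iSup (fun n => (s n : Ordinal.{0})) n⟩

theorem exists_gt_Iio_omega_one (a : Iio (ω₁ : Ordinal.{0})) : ∃ b, a < b :=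
  ⟨⟨Order.succ a.1, (Cardinal.isSuccLimit_omega 1).succ_lt a.2⟩, Order.lt_succ a.1⟩

/-- A compact Fréchet–Urysohn space admits no `ω₁`-sequence of functions `φ`, all equal
to `1` at `p`, such that each fibre of the initial functions meets the zero set of the next. -/
theorem not_exists_omega_one_functions {X : Type*} [TopologicalSpace X] [CompactSpace X]
    [FrechetUrysohnSpace X] (p : X) (φ : Iio (ω₁ : Ordinal.{0}) → C(X, ℝ))
    (hp : ∀ a, φ a p = 1)
    (hφ : ∀ a z, ∃ y, (∀ b < a, φ b y = φ b z) ∧ φ a y = 0) : False := by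
  have hfin : ∀ (a : Iio (ω₁ : Ordinal.{0})) (s : Finset (Iio (ω₁ : Ordinal.{0}))),
      ∃ y, (∀ b < a, φ b y = 1) ∧ ∀ b ∈ s, a ≤ b → φ b y = 0 := by
    intro a s
    induction s using Finset.induction_on_max with
    | empty => exact ⟨p, fun b _ => hp b, by simp⟩
    | insert c s hc ih =>
      obtain ⟨z, hz1, hz0⟩ := ih
      by_cases hac : a ≤ c
      · obtain ⟨y, hy, hy0⟩ := hφ c z
        refine ⟨y, fun b hb => (hy b (hb.trans_le hac)).trans (hz1 b hb), fun b hb hab => ?_⟩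
        rcases Finset.mem_insert.1 hb with rfl | hb
        · exact hy0
        · exact (hy b (hc b hb)).trans (hz0 b hb hab)
      · refine ⟨z, hz1, fun b hb hab => ?_⟩
        rcases Finset.mem_insert.1 hb with rfl | hb
        · exact absurd hab hac
        · exact hz0 b hb hab
  have hy : ∀ a, ∃ y, (∀ b < a, φ b y = 1) ∧ ∀ b, a ≤ b → φ b y = 0 := by
    intro a
    obtain ⟨y, hy⟩ := CompactSpace.iInter_nonempty
      (t := fun b => {y | (∀ c < a, φ c y = 1) ∧ (a ≤ b → φ b y = 0)}) (fun b => by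
        simp only [ofPred_and, ofPred_forall]
        refine IsClosed.inter (isClosed_iInter fun c => isClosed_iInter fun _ =>
          isClosed_eq (φ c).continuous continuous_const) (isClosed_iInter fun _ =>
          isClosed_eq (φ b).continuous continuous_const))
      (fun s => by
        obtain ⟨y, hy1, hy0⟩ := hfin a s
        exact ⟨y, mem_iInter₂.2 fun b hb => ⟨hy1, hy0 b hb⟩⟩)
    rw [mem_iInter] at hy
    exact ⟨y, (hy a).1, fun b => (hy b).2⟩
  choose y hy1 hy0 using hy
  obtain ⟨q, hq⟩ := CompactSpace.iInter_nonempty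
    (t := fun a => closure (y '' Ici a)) (fun _ => isClosed_closure) (fun s => by
      obtain ⟨m, hm⟩ : ∃ m, ∀ a ∈ s, a ≤ m := by
        rcases s.eq_empty_or_nonempty with rfl | hs
        · exact ⟨⟨0, Ordinal.omega_pos 1⟩, by simp⟩
        · exact ⟨s.max' hs, fun a ha => s.le_max' a ha⟩
      exact ⟨y m, mem_iInter₂.2 fun a ha => subset_closure ⟨m, hm a ha, rfl⟩⟩)
  rw [mem_iInter] at hq
  have hq1 : ∀ b, φ b q = 1 := by
    intro b
    obtain ⟨a, hba⟩ := exists_gt_Iio_omega_one b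
    refine closure_minimal (t := {x | φ b x = 1}) ?_
      (isClosed_eq (φ b).continuous continuous_const) (hq a)
    rintro _ ⟨c, hc, rfl⟩
    exact hy1 c b (hba.trans_le hc)
  obtain ⟨u, hu, huq⟩ := mem_closure_iff_seq_limit.1 (hq ⟨0, Ordinal.omega_pos 1⟩)
  choose s _ hs using hu
  obtain ⟨a, ha⟩ := exists_forall_le_of_seq_Iio_omega_one s
  have h0 : φ a q = 0 := by
    refine tendsto_nhds_unique (((φ a).continuous.tendsto q).comp huq) ?_
    refine tendsto_const_nhds.congr fun n => ?_
    simp [← hs, hy0 (s n) a (ha n)]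
  exact zero_ne_one (h0.symm.trans (hq1 a))

/-- In a compact Hausdorff Fréchet–Urysohn space every point has a countable `π`-base consisting
of fibres of countably many continuous functions. -/
theorem exists_countable_fibre_piBase {X : Type*} [TopologicalSpace X] [CompactSpace X]
    [T2Space X] [FrechetUrysohnSpace X] (p : X) :
    ∃ Φ : Set C(X, ℝ), Φ.Countable ∧
      ∀ V ∈ 𝓝 p, ∃ z ∈ V, ∀ y, (∀ φ ∈ Φ, φ y = φ z) → y ∈ V := by
  by_contra! H
  have H' : ∀ Φ : Set C(X, ℝ), ∃ ψ : C(X, ℝ), Φ.Countable →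
      ψ p = 1 ∧ ∀ z, ∃ y, (∀ φ ∈ Φ, φ y = φ z) ∧ ψ y = 0 := by
    intro Φ
    by_cases hΦ : Φ.Countable
    · obtain ⟨V, hV, h⟩ := H Φ hΦ
      obtain ⟨ψ, h0, h1, -⟩ := exists_continuous_zero_one_of_isClosed
        (s := (interior V)ᶜ) (t := {p}) isOpen_interior.isClosed_compl isClosed_singleton
        (by simpa using mem_interior_iff_mem_nhds.2 hV)
      refine ⟨ψ, fun _ => ⟨h1 rfl, fun z => ?_⟩⟩
      by_cases hz : z ∈ V
      · obtain ⟨y, hy, hyV⟩ := h z hz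
        exact ⟨y, hy, h0 fun h => hyV (interior_subset h)⟩
      · exact ⟨z, fun _ _ => rfl, h0 fun h => hz (interior_subset h)⟩
    · exact ⟨0, fun h => absurd h hΦ⟩
  choose F hF using H'
  let φ : Iio (ω₁ : Ordinal.{0}) → C(X, ℝ) :=
    WellFounded.fix (C := fun _ => C(X, ℝ)) wellFounded_lt
      fun a ih => F (range fun b : Iio a => ih b b.2)
  have hφ : ∀ a, φ a = F (φ '' Iio a) := by
    intro a
    rw [image_eq_range]
    exact WellFounded.fix_eq _ _ _
  have hc : ∀ a, (φ '' Iio a).Countable := fun a => (countable_Iio_of_Iio_omega_one a).image φ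
  refine not_exists_omega_one_functions p φ (fun a => ?_) fun a z => ?_
  · rw [hφ]
    exact (hF _ (hc a)).1
  · obtain ⟨y, hy, hy0⟩ := (hF _ (hc a)).2 z
    exact ⟨y, fun b hb => hy _ ⟨b, hb, rfl⟩, by rw [hφ]; exact hy0⟩

theorem countable_subgroupClosure {G : Type*} [Group G] {s : Set G} (hs : s.Countable) :
    (Subgroup.closure s : Set G).Countable := by
  have := hs.to_subtype
  have h := FreeGroup.range_lift_eq_closure (f := ((↑) : s → G))
  rw [Subtype.range_coe] at h
  rw [← h, MonoidHom.coe_range]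
  exact countable_range _

section RightTopologicalGroup

variable {G : Type*} [Group G] [TopologicalSpace G]

theorem exists_countable_separating_translates [CompactSpace G] [T2Space G] [FrechetUrysohnSpace G]
    (hright : ∀ h : G, Continuous fun g : G => g * h) :
    ∃ Φ : Set C(G, ℝ), Φ.Countable ∧
      ∀ h h' : G, (∀ φ ∈ Φ, ∀ g, φ (g * h) = φ (g * h')) → h = h' := by
  obtain ⟨Φ, hΦ, hfib⟩ := exists_countable_fibre_piBase (1 : G)
  refine ⟨Φ, hΦ, fun h h' hh => ?_⟩
  by_contra hne
  obtain ⟨A, B, hA, hB, h1A, hB', hAB⟩ := t2_separation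
    (show (1 : G) ≠ h⁻¹ * h' by rwa [ne_comm, Ne, inv_mul_eq_one])
  have hV : A ∩ (fun g => g * (h⁻¹ * h')) ⁻¹' B ∈ 𝓝 (1 : G) :=
    inter_mem (hA.mem_nhds h1A)
      ((hright _).continuousAt.preimage_mem_nhds (hB.mem_nhds (by simpa using hB')))
  obtain ⟨z, hz, hzV⟩ := hfib _ hV
  have := hzV (z * (h⁻¹ * h')) fun φ hφ => by
    simpa [mul_assoc] using (hh φ hφ (z * h⁻¹)).symm
  exact disjoint_left.1 hAB this.1 hz.2

theorem metrizable_of_countable_subset_center [CompactSpace G] [T2Space G]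
    [FrechetUrysohnSpace G] (hright : ∀ h : G, Continuous fun g : G => g * h) {Γ : Set G}
    (hΓ : Γ.Countable) (hΓd : Dense Γ) (hΓc : ∀ γ ∈ Γ, Continuous fun h : G => γ * h) :
    TopologicalSpace.MetrizableSpace G := by
  obtain ⟨Φ, hΦ, hsep⟩ := exists_countable_separating_translates hright
  have := hΓ.to_subtype
  have := hΦ.to_subtype
  let F : G → (Φ × Γ → ℝ) := fun h i => i.1.1 (i.2 * h)
  have hF : Continuous F :=
    continuous_pi fun i => i.1.1.continuous.comp (hΓc i.2 i.2.2)
  refine (hF.isClosedEmbedding fun h h' hh => hsep h h' fun φ hφ => ?_).isEmbedding.metrizableSpace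
  refine congrFun (Continuous.ext_on hΓd (φ.continuous.comp (hright h))
    (φ.continuous.comp (hright h')) fun γ hγ => ?_)
  exact congrFun hh (⟨φ, hφ⟩, ⟨γ, hγ⟩)

theorem tendsto_mul_one_of_metrizable [CompactSpace G] [TopologicalSpace.MetrizableSpace G]
    (hright : ∀ h : G, Continuous fun g : G => g * h)
    (hadm : Dense {g : G | Continuous fun h : G => g * h}) :
    Tendsto (fun p : G × G => p.1 * p.2) (𝓝 (1, 1)) (𝓝 1) := by
  let := TopologicalSpace.metrizableSpaceMetric G
  intro W hW
  obtain ⟨W', hW'W, hW'o, h1W'⟩ := mem_nhds_iff.1 hW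
  let H : TopologicalSpace.countableBasis G → Set G :=
    fun b => {h | h ∈ b.1 ∧ ∀ x ∈ b.1, x * h⁻¹ ∈ W'}
  have hHcov : ⋃ b, closure (H b) = univ := by
    refine eq_univ_of_forall fun h => ?_
    obtain ⟨b, hb, hhb, hbs⟩ := (TopologicalSpace.isBasis_countableBasis G).exists_subset_of_mem_open
      (show h ∈ (fun x => x * h⁻¹) ⁻¹' W' by simpa using h1W') (hW'o.preimage (hright _))
    exact mem_iUnion.2 ⟨⟨b, hb⟩, subset_closure ⟨hhb, fun x hx => hbs hx⟩⟩
  have := (TopologicalSpace.countable_countableBasis G).to_subtype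
  obtain ⟨b, x₁, hx₁⟩ := nonempty_interior_of_iUnion_of_closed (fun _ => isClosed_closure) hHcov
  have hbo : IsOpen b.1 := TopologicalSpace.isOpen_of_mem_countableBasis b.2
  obtain ⟨x₀, hx₀i, hx₀⟩ := mem_closure_iff.1 (interior_subset hx₁) _ isOpen_interior hx₁
  obtain ⟨ε, hε, hball⟩ := Metric.isOpen_iff.1 hbo x₀ hx₀.1
  let F : ℕ → Set G := fun n => {h | ∀ u, (Continuous fun h : G => u * h) →
    u ∈ Metric.ball (1 : G) (1 / (n + 1)) → dist (u * h) h ≤ ε / 2}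
  have hFc : ∀ n, IsClosed (F n) := by
    intro n
    simp only [F, ofPred_forall]
    exact isClosed_iInter fun u => isClosed_iInter fun hu => isClosed_iInter fun _ =>
      isClosed_le (hu.dist continuous_id) continuous_const
  have hFcov : ⋃ n, F n = univ := by
    refine eq_univ_of_forall fun h => ?_
    have hnear : ∀ᶠ u in 𝓝 (1 : G), dist (u * h) h < ε / 2 := by
      refine ((hright h).dist continuous_const).continuousAt.eventually_lt continuousAt_const ?_
      simpa using hε
    obtain ⟨δ, hδ, hδh⟩ := Metric.eventually_nhds_iff_ball.1 hnear
    obtain ⟨n, hn⟩ := exists_nat_one_div_lt hδ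
    exact mem_iUnion.2 ⟨n, fun u _ hu => (hδh u (Metric.ball_subset_ball hn.le hu)).le⟩
  obtain ⟨x₂, ⟨hx₂b, hx₂i⟩, hx₂⟩ :=
    (dense_iUnion_interior_of_closed hFc hFcov).inter_open_nonempty
      (Metric.ball x₀ (ε / 2) ∩ interior (closure (H b)))
      (Metric.isOpen_ball.inter isOpen_interior) ⟨x₀, Metric.mem_ball_self (half_pos hε), hx₀i⟩
  obtain ⟨n, hn⟩ := mem_iUnion.1 hx₂
  obtain ⟨h, ⟨hhb, hhF⟩, hhH⟩ := mem_closure_iff.1 (interior_subset hx₂i)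
    (Metric.ball x₀ (ε / 2) ∩ interior (F n)) (Metric.isOpen_ball.inter isOpen_interior)
    ⟨hx₂b, hn⟩
  have hU : Metric.ball (1 : G) (1 / (n + 1)) ∈ 𝓝 (1 : G) :=
    Metric.ball_mem_nhds _ (by positivity)
  have hV : (fun w => w * h) ⁻¹' (Metric.ball x₀ (ε / 2) ∩ interior (F n)) ∈ 𝓝 (1 : G) :=
    (hright h).continuousAt.preimage_mem_nhds
      ((Metric.isOpen_ball.inter isOpen_interior).mem_nhds (by simpa using ⟨hhb, hhF⟩))
  rw [nhds_prod_eq, mem_map]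
  refine mem_of_superset (prod_mem_prod hU hV) ?_
  rintro ⟨u, w⟩ ⟨hu, hwb, hwF⟩
  have hclose : dist (u * (w * h)) (w * h) ≤ ε / 2 := by
    refine closure_minimal (t := {u | dist (u * (w * h)) (w * h) ≤ ε / 2}) ?_
      (isClosed_le ((hright _).dist continuous_const) continuous_const)
      (hadm.open_subset_closure_inter Metric.isOpen_ball hu)
    exact fun v hv => interior_subset hwF v hv.2 hv.1
  have hmem : u * (w * h) ∈ b.1 := hball <| by
    have hwb' : dist (w * h) x₀ < ε / 2 := hwb
    rw [Metric.mem_ball]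
    linarith [dist_triangle (u * (w * h)) (w * h) x₀]
  have := hhH.2 _ hmem
  exact hW'W (by simpa [mul_assoc] using this)

theorem eventually_forall_abs_sub_lt [CompactSpace G]
    (hright : ∀ h : G, Continuous fun g : G => g * h)
    (hmul : Tendsto (fun p : G × G => p.1 * p.2) (𝓝 (1, 1)) (𝓝 1))
    (φ : C(G, ℝ)) {ε : ℝ} (hε : 0 < ε) :
    ∀ᶠ g in 𝓝 (1 : G), ∀ h, |φ (g * h) - φ h| < ε := by
  have key := isCompact_univ.eventually_forall_of_forall_eventually (x₀ := (1 : G))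
    (P := fun g h : G => |φ (g * h) - φ h| < ε) fun k _ => ?_
  · simpa using key
  have h1 : Tendsto (fun p : G × G => p.1 * p.2) (𝓝 (1, k)) (𝓝 k) := by
    have hc : Tendsto (fun p : G × G => (p.1, p.2 * k⁻¹)) (𝓝 (1, k)) (𝓝 (1, 1)) := by
      have : Continuous fun p : G × G => (p.1, p.2 * k⁻¹) :=
        continuous_fst.prodMk ((hright _).comp continuous_snd)
      simpa using this.tendsto (1, k)
    have := ((hright k).tendsto 1).comp (hmul.comp hc)
    simpa [Function.comp_def, mul_assoc] using this
  have h2 : Tendsto (fun p : G × G => |φ (p.1 * p.2) - φ p.2|) (𝓝 (1, k)) (𝓝 0) := by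
    have := (((φ.continuous.tendsto k).comp h1).sub
      ((φ.continuous.comp continuous_snd).tendsto ((1 : G), k))).abs
    simpa [Function.comp_def] using this
  exact h2.eventually_lt_const hε

/-- The topological center of a compact Hausdorff right topological group, as a subgroup. -/
def rightTopologicalCenter [CompactSpace G] [T2Space G] : Subgroup G where
  carrier := {g | Continuous fun h : G => g * h}
  mul_mem' {a b} ha hb := by
    have := Continuous.comp (show Continuous fun h : G => a * h from ha)
      (show Continuous fun h : G => b * h from hb)
    simpa [Function.comp_def, mul_assoc] using this
  one_mem' := by simpa using continuous_id'
  inv_mem' {a} ha :=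
    (Continuous.homeoOfEquivCompactToT2 (f := Equiv.mulLeft a) ha).symm.continuous

/-- The closure of a subgroup of the topological center is a subgroup. -/
def closureSubgroup [CompactSpace G] [T2Space G]
    (hright : ∀ h : G, Continuous fun g : G => g * h) (Γ : Subgroup G)
    (hΓ : Γ ≤ rightTopologicalCenter) : Subgroup G :=
  have hmul : ∀ a ∈ closure (Γ : Set G), ∀ b ∈ closure (Γ : Set G),
      a * b ∈ closure (Γ : Set G) := by
    intro a ha b hb
    have hb' : ∀ γ ∈ Γ, γ * b ∈ closure (Γ : Set G) := fun γ hγ =>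
      map_mem_closure (f := fun h => γ * h) (hΓ hγ) hb fun δ hδ => Γ.mul_mem hγ hδ
    exact closure_minimal (t := (fun g => g * b) ⁻¹' closure (Γ : Set G)) hb'
      (isClosed_closure.preimage (hright b)) ha
  { carrier := closure (Γ : Set G)
    mul_mem' := fun {a b} ha hb => hmul a ha b hb
    one_mem' := subset_closure Γ.one_mem
    inv_mem' := fun {a} ha => by
      obtain ⟨_, ⟨m, hm, rfl⟩, hidem⟩ := exists_idempotent_in_compact_subsemigroup hright
        ((fun g => g * a) '' closure (Γ : Set G)) ⟨_, mem_image_of_mem _ ha⟩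
        (isClosed_closure.isCompact.image (hright a)) (by
          rintro _ ⟨x, hx, rfl⟩ _ ⟨y, hy, rfl⟩
          exact ⟨x * a * y, hmul _ (hmul _ hx _ ha) _ hy, by simp [mul_assoc]⟩)
      have h1 : m * a = 1 := by simpa using hidem
      rw [← eq_inv_of_mul_eq_one_left h1]
      exact hm }

theorem tendsto_sub_of_tendsto_one [CompactSpace G] [T2Space G] [FrechetUrysohnSpace G]
    (hright : ∀ h : G, Continuous fun g : G => g * h)
    (hadm : Dense {g : G | Continuous fun h : G => g * h}) (φ : C(G, ℝ)) {u v : ℕ → G}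
    (hu : Tendsto u atTop (𝓝 1)) :
    Tendsto (fun n => |φ (u n * v n) - φ (v n)|) atTop (𝓝 0) := by
  have hseq : ∀ x : G, ∃ s : ℕ → G, (∀ n, s n ∈ rightTopologicalCenter) ∧
      Tendsto s atTop (𝓝 x) := fun x => mem_closure_iff_seq_limit.1 (hadm x)
  choose s hsc hs using hseq
  let Γ : Subgroup G := Subgroup.closure
    ((range fun i : ℕ × ℕ => s (u i.1) i.2) ∪ range fun i : ℕ × ℕ => s (v i.1) i.2)
  have hΓc : Γ ≤ rightTopologicalCenter := by
    rw [Subgroup.closure_le]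
    rintro _ (⟨i, rfl⟩ | ⟨i, rfl⟩) <;> exact hsc _ _
  have hΓ : (Γ : Set G).Countable :=
    countable_subgroupClosure ((countable_range _).union (countable_range _))
  let H := closureSubgroup hright Γ hΓc
  have hHcl : IsClosed (H : Set G) := isClosed_closure
  have huH : ∀ n, u n ∈ H := fun n => mem_closure_of_tendsto (hs (u n))
    (Eventually.of_forall fun m => Subgroup.subset_closure (.inl ⟨(n, m), rfl⟩))
  have hvH : ∀ n, v n ∈ H := fun n => mem_closure_of_tendsto (hs (v n))
    (Eventually.of_forall fun m => Subgroup.subset_closure (.inr ⟨(n, m), rfl⟩))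
  have : CompactSpace H := isCompact_iff_compactSpace.1 hHcl.isCompact
  have hrightH : ∀ h : H, Continuous fun g : H => g * h := fun h =>
    ((hright h).comp continuous_subtype_val).subtype_mk _
  let ΓH : Set H := (↑) ⁻¹' (Γ : Set G)
  have hΓHd : Dense ΓH := fun x => by
    have himage : ((↑) : H → G) '' ΓH = Γ :=
      (Subtype.image_preimage_coe _ _).trans (inter_eq_right.2 subset_closure)
    rw [closure_subtype, himage]
    exact x.2
  have hΓHc : ∀ γ ∈ ΓH, Continuous fun h : H => γ * h := fun γ hγ =>
    (Continuous.comp (hΓc hγ) continuous_subtype_val).subtype_mk _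
  have := metrizable_of_countable_subset_center hrightH
    (hΓ.preimage Subtype.val_injective) hΓHd hΓHc
  have hmul := tendsto_mul_one_of_metrizable hrightH (hΓHd.mono hΓHc)
  have huH1 : Tendsto (fun n => (⟨u n, huH n⟩ : H)) atTop (𝓝 1) :=
    tendsto_subtype_rng.2 hu
  rw [Metric.tendsto_nhds]
  intro ε hε
  filter_upwards [huH1.eventually (eventually_forall_abs_sub_lt hrightH hmul
    (φ.comp ⟨Subtype.val, continuous_subtype_val⟩) hε)] with n hn
  simpa using hn ⟨v n, hvH n⟩

theorem continuousMul_of_eventually_forall_abs_sub_lt [CompactSpace G] [T2Space G]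
    (hright : ∀ h : G, Continuous fun g : G => g * h)
    (hadm : Dense {g : G | Continuous fun h : G => g * h})
    (hunif : ∀ (φ : C(G, ℝ)) (ε : ℝ), 0 < ε →
      ∀ᶠ g in 𝓝 (1 : G), ∀ h, |φ (g * h) - φ h| < ε) : ContinuousMul G := by
  have hunif' : ∀ (φ : C(G, ℝ)) (ε : ℝ), 0 < ε → ∀ g₀ : G,
      ∀ᶠ g in 𝓝 g₀, ∀ h, |φ (g * h) - φ (g₀ * h)| < ε := by
    intro φ ε hε g₀
    have ht : Tendsto (fun g => g * g₀⁻¹) (𝓝 g₀) (𝓝 1) := by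
      simpa using (hright g₀⁻¹).tendsto g₀
    filter_upwards [ht.eventually (hunif φ ε hε)] with g hg h
    simpa [mul_assoc] using hg (g₀ * h)
  have hind : IsInducing fun (x : G) (φ : C(G, ℝ)) => φ x :=
    ((continuous_pi fun φ : C(G, ℝ) => φ.continuous).isClosedEmbedding fun x y hxy => by
      by_contra hne
      obtain ⟨ψ, h0, h1, -⟩ := exists_continuous_zero_one_of_isClosed
        (isClosed_singleton (x := x)) (isClosed_singleton (x := y)) (by simpa using hne)
      have := congrFun hxy ψ
      simp [h0 rfl, h1 rfl] at this).isInducing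
  have hleft : ∀ g₀ : G, Continuous fun h : G => g₀ * h := by
    intro g₀
    rw [hind.continuous_iff]
    refine continuous_pi fun φ => ?_
    refine continuous_of_uniform_approx_of_continuous fun U hU => ?_
    obtain ⟨ε, hε, hεU⟩ := Metric.mem_uniformity_dist.1 hU
    obtain ⟨g, hg, hgc⟩ := hadm.exists_mem_open isOpen_interior
      ⟨g₀, mem_interior_iff_mem_nhds.2 (hunif' φ ε hε g₀)⟩
    refine ⟨fun h => φ (g * h), φ.continuous.comp hg, fun h => hεU ?_⟩
    rw [dist_comm]
    exact interior_subset hgc h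
  refine ⟨?_⟩
  rw [hind.continuous_iff]
  refine continuous_pi fun φ => continuous_iff_continuousAt.2 fun ⟨g₀, h₀⟩ => ?_
  refine Metric.tendsto_nhds.2 fun ε hε => ?_
  have h2 := Metric.tendsto_nhds.1 ((φ.continuous.comp (hleft g₀)).tendsto h₀) _ (half_pos hε)
  rw [nhds_prod_eq]
  filter_upwards [(hunif' φ _ (half_pos hε) g₀).prod_mk h2] with p hp
  have h3 : dist (φ (p.1 * p.2)) (φ (g₀ * p.2)) < ε / 2 := hp.1 p.2
  have h4 : dist (φ (g₀ * p.2)) (φ (g₀ * h₀)) < ε / 2 := hp.2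
  have := dist_triangle (φ (p.1 * p.2)) (φ (g₀ * p.2)) (φ (g₀ * h₀))
  simp only [Function.comp_apply]
  linarith

theorem continuousMul_of_chart_frechetUrysohn [CompactSpace G] [T2Space G]
    [FrechetUrysohnSpace G] (hright : ∀ h : G, Continuous fun g : G => g * h)
    (hadm : Dense {g : G | Continuous fun h : G => g * h}) : ContinuousMul G := by
  refine continuousMul_of_eventually_forall_abs_sub_lt hright hadm fun φ ε hε => ?_
  by_contra hcon
  obtain ⟨u, hu, hu1⟩ := mem_closure_iff_seq_limit.1 (mem_closure_iff_frequently.2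
    (not_eventually.1 hcon) : (1 : G) ∈ closure {g | ¬ ∀ h, |φ (g * h) - φ h| < ε})
  have hv : ∀ n, ∃ h, ε ≤ |φ (u n * h) - φ h| := fun n => by
    simpa using hu n
  choose v hv using hv
  obtain ⟨n, hn⟩ := ((tendsto_sub_of_tendsto_one hright hadm φ (v := v)
    hu1).eventually_lt_const hε).exists
  exact (hv n).not_gt hn

end RightTopologicalGroup

/-- Every Fréchet–Urysohn CHART group (compact Hausdorff admissible right
topological group) is metrizable. -/
theorem metrizable_of_chart_frechetUrysohn {G : Type*} [Group G] [TopologicalSpace G]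
    [CompactSpace G] [T2Space G] [FrechetUrysohnSpace G]
    (hright : ∀ h : G, Continuous fun g : G => g * h)
    (hadm : Dense {g : G | Continuous fun h : G => g * h}) :
    TopologicalSpace.MetrizableSpace G := by
  have := continuousMul_of_chart_frechetUrysohn hright hadm
  obtain ⟨Φ, hΦ, hsep⟩ := exists_countable_separating_translates hright
  have := hΦ.to_subtype
  let F : G → (Φ → C(G, ℝ)) := fun h φ =>
    ContinuousMap.curry ⟨fun p : G × G => φ.1 (p.2 * p.1), by fun_prop⟩ h
  have hF : Continuous F := continuous_pi fun φ => ContinuousMap.continuous _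
  refine (hF.isClosedEmbedding fun h h' hh => hsep h h' fun φ hφ g => ?_).isEmbedding.metrizableSpace
  exact DFunLike.congr_fun (congrFun hh ⟨φ, hφ⟩) g
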